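/- For every subset I ⊆ Π: F_I is an exposed face of H; F_I = H ∩ (μ − ℝ₊I); F_I = W_I·(F_I ∩ C̄); and F_I ∩ (W·μ) = W_I·μ. -/

import Mathlib

open Set Module

noncomputable section

/-- The linear reflection `x ↦ x - f x • a` associated to a vector `a` and a linear
functional `f` with `f a = 2`, bundled as a linear automorphism. -/
def reflEquiv {V : Type*} [AddCommGroup V] [Module ℝ V]
    (a : V) (f : V →ₗ[ℝ] ℝ) (h2 : f a = 2) : V ≃ₗ[ℝ] V :=
  LinearEquiv.ofInvolutive (LinearMap.id - f.smulRight a)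
    (fun x => by
      simp only [LinearMap.sub_apply, LinearMap.id_apply, LinearMap.smulRight_apply,
        map_sub, map_smul, smul_eq_mul, h2]
      module)

/-- A realization over `ℝ` of an `m × m` generalized Cartan matrix `A`:
simple roots `α_i`, simple coroots `α_i∨` (as linear functionals), with
`⟨α_j, α_i∨⟩ = a_{ij}`, together with the defining axioms. -/
structure GCMRealization (m : ℕ) (V : Type*) [NormedAddCommGroup V] [NormedSpace ℝ V] where
  A : Matrix (Fin m) (Fin m) ℤ
  root : Fin m → V
  coroot : Fin m → V →ₗ[ℝ] ℝ
  one_le_m : 1 ≤ m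
  A_diag : ∀ i, A i i = 2
  A_offdiag : ∀ i j, i ≠ j → A i j ≤ 0
  A_zero_iff : ∀ i j, A i j = 0 ↔ A j i = 0
  root_indep : LinearIndependent ℝ root
  coroot_indep : LinearIndependent ℝ coroot
  pairing : ∀ i j, coroot i (root j) = (A i j : ℝ)
  finDim : FiniteDimensional ℝ V
  dim_eq : finrank ℝ V + (A.map ((↑) : ℤ → ℝ)).rank = 2 * m

/-- A face of a convex set `H`: a convex subset `F ⊆ H` such that whenever the open
segment between two points of `H` meets `F`, both points lie in `F`. -/
def IsFaceOf {V : Type*} [NormedAddCommGroup V] [NormedSpace ℝ V] (H F : Set V) : Prop :=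
  Convex ℝ F ∧ IsExtreme ℝ H F

namespace GCMRealization

variable {m : ℕ} {V : Type*} [NormedAddCommGroup V] [NormedSpace ℝ V]
variable (S : GCMRealization m V)

/-- The fundamental reflection `r_i`. -/
def s (i : Fin m) : V ≃ₗ[ℝ] V :=
  reflEquiv (S.root i) (S.coroot i) (by
    have h := S.pairing i i
    rw [S.A_diag i] at h
    simpa using h)

/-- The Weyl group `W`, as a subgroup of the group of linear automorphisms of `V`. -/
def W : Subgroup (V ≃ₗ[ℝ] V) := Subgroup.closure (Set.range S.s)

/-- The standard parabolic subgroup `W_I` generated by the reflections indexed by `I`. -/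
def WI (I : Set (Fin m)) : Subgroup (V ≃ₗ[ℝ] V) := Subgroup.closure (S.s '' I)

/-- The closed fundamental chamber `C̄`. -/
def chamber : Set V := {η | ∀ i, 0 ≤ S.coroot i η}

/-- `J₀`: the set of indices `i` with `⟨μ, α_i∨⟩ = 0`. -/
def J0 (μ : V) : Set (Fin m) := {i | S.coroot i μ = 0}

/-- The orbit of `μ` under a subgroup of linear automorphisms. -/
def orbitOf (G : Subgroup (V ≃ₗ[ℝ] V)) (μ : V) : Set V :=
  (fun w : V ≃ₗ[ℝ] V => w μ) '' (G : Set (V ≃ₗ[ℝ] V))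

/-- `F_I`: the convex hull of `W_I · μ`. -/
def face (μ : V) (I : Set (Fin m)) : Set V := convexHull ℝ (orbitOf (S.WI I) μ)

/-- `H`: the convex hull of the Weyl group orbit of `μ`. -/
def orbitHull (μ : V) : Set V := convexHull ℝ (orbitOf S.W μ)

/-- `ℝ₊I`: the set of nonnegative linear combinations of the simple roots indexed by `I`. -/
def coneNonneg (I : Set (Fin m)) : Set V :=
  {v | ∃ c : Fin m → ℝ, (∀ i, 0 ≤ c i) ∧ (∀ i, i ∉ I → c i = 0) ∧ v = ∑ i, c i • S.root i}

/-- `ℝ_>I`: the set of strictly positive linear combinations of the simple roots indexed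
by `I` (with `ℝ_>∅ = {0}`). -/
def conePos (I : Set (Fin m)) : Set V :=
  {v | ∃ c : Fin m → ℝ, (∀ i ∈ I, 0 < c i) ∧ (∀ i, i ∉ I → c i = 0) ∧ v = ∑ i, c i • S.root i}

/-- The open standard facet `C_J`. -/
def openFacet (J : Set (Fin m)) : Set V :=
  {η | (∀ i ∈ J, S.coroot i η = 0) ∧ ∀ i, i ∉ J → 0 < S.coroot i η}

/-- The closed standard facet `C̄_J`. -/
def closedFacet (J : Set (Fin m)) : Set V :=
  {η | (∀ i ∈ J, S.coroot i η = 0) ∧ ∀ i, i ∉ J → 0 ≤ S.coroot i η}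

/-- Adjacency of two vertices of the Dynkin diagram: `i ≠ j` and `a_{ij} ≠ 0`
(equivalently `a_{ji} ≠ 0`). -/
def Adjacent (i j : Fin m) : Prop := i ≠ j ∧ S.A i j ≠ 0 ∧ S.A j i ≠ 0

/-- The Dynkin diagram, as a simple graph on the index set. -/
def diagram : SimpleGraph (Fin m) where
  Adj := S.Adjacent
  symm := ⟨fun _ _ h => ⟨h.1.symm, h.2.2, h.2.1⟩⟩
  loopless := ⟨fun _ h => h.1 rfl⟩

/-- A subset `I` is `μ`-connected if every connected component of `I` meets
`J_> = Π \ J₀` (the empty set is `μ`-connected). -/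
def MuConnected (μ : V) (I : Set (Fin m)) : Prop :=
  ∀ i : I, ∃ j : I, S.coroot (j : Fin m) μ ≠ 0 ∧ (S.diagram.induce I).Reachable i j

/-- The connected component of `i` inside `K`, as a subset of the index set. -/
def comp (K : Set (Fin m)) (i : Fin m) : Set (Fin m) :=
  {j | ∃ (hi : i ∈ K) (hj : j ∈ K), (S.diagram.induce K).Reachable ⟨i, hi⟩ ⟨j, hj⟩}

/-- `I*`: the largest `μ`-connected subset of `I`, i.e. the union of the connected
components of `I` that meet `J_>`. -/
def muPart (μ : V) (I : Set (Fin m)) : Set (Fin m) :=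
  {j | ∃ (hj : j ∈ I) (k : Fin m) (hk : k ∈ I), S.coroot k μ ≠ 0 ∧
    (S.diagram.induce I).Reachable ⟨j, hj⟩ ⟨k, hk⟩}

/-- `I_*`: the set of `α ∈ J₀ \ I` orthogonal to all of `I`. -/
def starSet (μ : V) (I : Set (Fin m)) : Set (Fin m) :=
  {i | S.coroot i μ = 0 ∧ i ∉ I ∧ ∀ j ∈ I, S.coroot i (S.root j) = 0}

/-- A subset `K ⊆ Π` is of finite type if the subgroup `W_K` is finite. -/
def FiniteType (K : Set (Fin m)) : Prop := ((S.WI K : Subgroup (V ≃ₗ[ℝ] V)) : Set (V ≃ₗ[ℝ] V)).Finite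

/-- Every connected component of `K` is of finite type. -/
def FinTypeComponents (K : Set (Fin m)) : Prop := ∀ i ∈ K, S.FiniteType (S.comp K i)

/-- A fundamental face of `H`: a face which is empty or whose relative interior meets
the fundamental chamber. -/
def IsFundFace (μ : V) (F : Set V) : Prop :=
  IsFaceOf (S.orbitHull μ) F ∧ (F = ∅ ∨ (intrinsicInterior ℝ F ∩ S.chamber).Nonempty)

/-- The length of `w ∈ W` with respect to the fundamental reflections. -/
def len (w : V ≃ₗ[ℝ] V) : ℕ :=
  sInf {k | ∃ l : List (Fin m), l.length = k ∧ w = (l.map S.s).prod}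

end GCMRealization

end

namespace GCMRealization

section aux
variable {m : ℕ} {V : Type*} [NormedAddCommGroup V] [NormedSpace ℝ V]
variable (S : GCMRealization m V)

theorem s_apply (i : Fin m) (x : V) : S.s i x = x - S.coroot i x • S.root i := by
  rfl

theorem coroot_self (i : Fin m) : S.coroot i (S.root i) = 2 := by
  rw [S.pairing, S.A_diag]; norm_num

theorem s_mul_self (i : Fin m) : S.s i * S.s i = 1 := by
  ext x
  simp only [LinearEquiv.mul_apply, s_apply, map_sub, map_smul, coroot_self, smul_eq_mul,
    LinearEquiv.coe_one, id]
  module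

theorem s_inv (i : Fin m) : (S.s i)⁻¹ = S.s i := by
  rw [inv_eq_iff_mul_eq_one, s_mul_self]

theorem s_mem (i : Fin m) : S.s i ∈ S.W := Subgroup.subset_closure ⟨i, rfl⟩

theorem prod_mem (l : List (Fin m)) : (l.map S.s).prod ∈ S.W := by
  apply Subgroup.list_prod_mem
  intro x hx
  obtain ⟨i, -, rfl⟩ := List.mem_map.1 hx
  exact S.s_mem i

theorem exists_word {w : V ≃ₗ[ℝ] V} (hw : w ∈ S.W) :
    ∃ l : List (Fin m), w = (l.map S.s).prod := by
  induction hw using Subgroup.closure_induction with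
  | mem x hx => obtain ⟨i, rfl⟩ := hx; exact ⟨[i], by simp⟩
  | one => exact ⟨[], by simp⟩
  | mul x y _ _ hx hy =>
    obtain ⟨l, rfl⟩ := hx
    obtain ⟨l', rfl⟩ := hy
    exact ⟨l ++ l', by simp⟩
  | inv x _ hx =>
    obtain ⟨l, rfl⟩ := hx
    refine ⟨l.reverse, ?_⟩
    rw [List.prod_inv_reverse, List.map_reverse, List.map_map]
    have e : (fun x : V ≃ₗ[ℝ] V => x⁻¹) ∘ S.s = S.s := by
      funext i
      simp [s_inv]
    simp [e, ← List.map_reverse]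

theorem len_le (l : List (Fin m)) : S.len (l.map S.s).prod ≤ l.length :=
  Nat.sInf_le ⟨l, rfl, rfl⟩

theorem exists_len {w : V ≃ₗ[ℝ] V} (hw : w ∈ S.W) :
    ∃ l : List (Fin m), l.length = S.len w ∧ w = (l.map S.s).prod := by
  obtain ⟨l, hl⟩ := S.exists_word hw
  exact Nat.sInf_mem (s := {k | ∃ l : List (Fin m), l.length = k ∧ w = (l.map S.s).prod})
    ⟨_, l, rfl, hl⟩

theorem len_mul_prod {w : V ≃ₗ[ℝ] V} (hw : w ∈ S.W) (l : List (Fin m)) :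
    S.len (w * (l.map S.s).prod) ≤ S.len w + l.length := by
  obtain ⟨l', h1, h2⟩ := S.exists_len hw
  have := S.len_le (l' ++ l)
  rw [List.map_append, List.prod_append, ← h2, List.length_append, h1] at this
  exact this

theorem len_mul_s {w : V ≃ₗ[ℝ] V} (hw : w ∈ S.W) (i : Fin m) :
    S.len (w * S.s i) ≤ S.len w + 1 := by
  simpa using S.len_mul_prod hw [i]

theorem exists_descent {w : V ≃ₗ[ℝ] V} (hw : w ∈ S.W) (h : S.len w ≠ 0) :
    ∃ t, S.len (w * S.s t) < S.len w := by
  obtain ⟨l, h1, h2⟩ := S.exists_len hw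
  rcases List.eq_nil_or_concat l with rfl | ⟨l', t, rfl⟩
  · simp at h1; omega
  · refine ⟨t, ?_⟩
    have : w * S.s t = (l'.map S.s).prod := by
      rw [h2]; simp [mul_assoc, s_mul_self]
    rw [this, ← h1]
    have := S.len_le l'
    simp; omega

theorem len_zero {w : V ≃ₗ[ℝ] V} (hw : w ∈ S.W) (h : S.len w = 0) : w = 1 := by
  obtain ⟨l, h1, h2⟩ := S.exists_len hw
  rw [h, List.length_eq_zero_iff] at h1
  subst h1; simpa using h2

/-- the alternating letter -/
noncomputable def letter (a b : Fin m) (k : ℕ) : Fin m := if Even k then b else a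

/-- alternating word of length k, whose last letter is b -/
noncomputable def alt (a b : Fin m) : ℕ → (V ≃ₗ[ℝ] V)
  | 0 => 1
  | k + 1 => S.s (letter a b k) * alt a b k

/-- alt k sends root a into the natural cone spanned by root a, root b -/
def Good (a b : Fin m) (k : ℕ) : Prop :=
  ∃ x y : ℕ, S.alt a b k (S.root a) = x • S.root a + y • S.root b

theorem coord_a (a b : Fin m) (x : V) (p u v : ℝ) (hp : S.coroot a (S.root b) = -p) :
    S.s a (x + u • S.root a + v • S.root b) =
      x + (-u + p * v - S.coroot a x) • S.root a + v • S.root b := by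
  simp only [s_apply, map_add, map_smul, coroot_self, hp, smul_eq_mul]
  module

theorem coord_b (a b : Fin m) (x : V) (q u v : ℝ) (hq : S.coroot b (S.root a) = -q) :
    S.s b (x + u • S.root a + v • S.root b) =
      x + u • S.root a + (-v + q * u - S.coroot b x) • S.root b := by
  simp only [s_apply, map_add, map_smul, coroot_self, hq, smul_eq_mul]
  module

theorem coord_a0 (a b : Fin m) (p u v : ℝ) (hp : S.coroot a (S.root b) = -p) :
    S.s a (u • S.root a + v • S.root b) =
      (-u + p * v) • S.root a + v • S.root b := by
  simpa using S.coord_a a b 0 p u v hp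

theorem coord_b0 (a b : Fin m) (q u v : ℝ) (hq : S.coroot b (S.root a) = -q) :
    S.s b (u • S.root a + v • S.root b) =
      u • S.root a + (-v + q * u) • S.root b := by
  simpa using S.coord_b a b 0 q u v hq

/-- numerical alternating sequence -/
def num (p q : ℤ) : ℕ → ℤ × ℤ
  | 0 => (1, 0)
  | k + 1 => if Even k then ((num p q k).1, -(num p q k).2 + q * (num p q k).1)
      else (-(num p q k).1 + p * (num p q k).2, (num p q k).2)

theorem alt_root (a b : Fin m) (p q : ℤ) (hp : S.coroot a (S.root b) = -(p : ℝ))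
    (hq : S.coroot b (S.root a) = -(q : ℝ)) (k : ℕ) :
    S.alt a b k (S.root a) =
      ((num p q k).1 : ℝ) • S.root a + ((num p q k).2 : ℝ) • S.root b := by
  induction k with
  | zero => simp [alt, num]
  | succ k ih =>
    rw [alt, LinearEquiv.mul_apply, ih]
    by_cases hk : Even k
    · simp only [letter, hk, if_true, num]
      rw [S.coord_b0 a b q _ _ hq]; push_cast; rfl
    · simp only [letter, hk, if_false, num]
      rw [S.coord_a0 a b p _ _ hp]; push_cast; rfl

theorem good_of_num (a b : Fin m) (p q : ℤ) (hp : S.coroot a (S.root b) = -(p : ℝ))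
    (hq : S.coroot b (S.root a) = -(q : ℝ)) (k : ℕ)
    (h : 0 ≤ (num p q k).1 ∧ 0 ≤ (num p q k).2) : S.Good a b k := by
  obtain ⟨h1, h2⟩ := h
  refine ⟨(num p q k).1.toNat, (num p q k).2.toNat, ?_⟩
  rw [S.alt_root a b p q hp hq]
  lift (num p q k).1 to ℕ using h1 with x
  lift (num p q k).2 to ℕ using h2 with y
  simp [Nat.cast_smul_eq_nsmul]

theorem num_big (p q : ℤ) (hp : 0 < p) (hq : 0 < q) (h : 4 ≤ p * q) (k : ℕ) :
    0 ≤ (num p q k).1 ∧ 0 ≤ (num p q k).2 ∧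
    (Even k → 2 * (num p q k).2 ≤ q * (num p q k).1) ∧
    (¬ Even k → 2 * (num p q k).1 ≤ p * (num p q k).2) := by
  induction k with
  | zero => simp [num]; try positivity
  | succ k ih =>
    obtain ⟨h1, h2, h3, h4⟩ := ih
    by_cases hk : Even k
    · simp only [num, hk, if_true, Nat.even_add_one, not_true, not_false_iff, false_imp_iff,
        true_imp_iff]
      have := h3 hk
      refine ⟨h1, by linarith, trivial, ?_⟩
      nlinarith
    · simp only [num, hk, if_false, Nat.even_add_one, not_true, not_false_iff, false_imp_iff,
        true_imp_iff]
      have := h4 hk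
      refine ⟨by linarith, h2, ?_, trivial⟩
      nlinarith

theorem rank_two (a b : Fin m) (hab : a ≠ b) :
    (∀ k, S.Good a b k) ∨ ∃ M, (∀ k < M, S.Good a b k) ∧
      ∃ l : List (Fin m), l.length < M ∧ S.alt a b M * S.s a = (l.map S.s).prod := by
  obtain ⟨p, hp⟩ : ∃ p : ℤ, p = - S.A a b := ⟨_, rfl⟩
  obtain ⟨q, hq⟩ : ∃ q : ℤ, q = - S.A b a := ⟨_, rfl⟩
  have hp0 : 0 ≤ p := by have := S.A_offdiag a b hab; omega
  have hq0 : 0 ≤ q := by have := S.A_offdiag b a hab.symm; omega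
  have hpq : p = 0 ↔ q = 0 := by have := S.A_zero_iff a b; omega
  have hpc : S.coroot a (S.root b) = -(p : ℝ) := by rw [S.pairing, hp]; simp
  have hqc : S.coroot b (S.root a) = -(q : ℝ) := by rw [S.pairing, hq]; simp
  clear hp hq
  have key := S.good_of_num a b p q hpc hqc
  by_cases h4 : 4 ≤ p * q
  · left
    intro k
    have hp1 : 0 < p := by
      rcases hp0.eq_or_lt with h | h
      · rw [← h] at h4; simp at h4
      · exact h
    have hq1 : 0 < q := by
      rcases hq0.eq_or_lt with h | h
      · rw [← h] at h4; simp at h4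
      · exact h
    have := num_big p q hp1 hq1 h4 k
    exact key k ⟨this.1, this.2.1⟩
  right
  have hcase : (p = 0 ∧ q = 0) ∨ (p = 1 ∧ q = 1) ∨ (p = 1 ∧ q = 2) ∨ (p = 2 ∧ q = 1) ∨
      (p = 1 ∧ q = 3) ∨ (p = 3 ∧ q = 1) := by
    rcases hp0.eq_or_lt with h | h
    · left; exact ⟨h.symm, hpq.1 h.symm⟩
    have hq1 : 0 < q := by
      rcases hq0.eq_or_lt with h' | h'
      · have := hpq.2 h'.symm; omega
      · exact h'
    have : p ≤ 3 := by nlinarith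
    have : q ≤ 3 := by nlinarith
    interval_cases p <;> interval_cases q <;> simp_all
  have e6 : ¬ Even 5 := by decide
  have e5 : Even 4 := by decide
  have e4 : ¬ Even 3 := by decide
  have e3 : Even 2 := by decide
  have e2 : ¬ Even 1 := by decide
  have e1 : Even 0 := by decide
  have ca := fun x u v => S.coord_a a b x p u v hpc
  have cb := fun x u v => S.coord_b a b x q u v hqc
  have st : ∀ x : V, x = x + (0 : ℝ) • S.root a + (0 : ℝ) • S.root b := by intro x; simp
  rcases hcase with ⟨rfl, rfl⟩ | ⟨rfl, rfl⟩ | ⟨rfl, rfl⟩ | ⟨rfl, rfl⟩ | ⟨rfl, rfl⟩ | ⟨rfl, rfl⟩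
  · refine ⟨2, fun k hk => key k ?_, [b], by simp, ?_⟩
    · interval_cases k <;> decide
    · ext x
      simp only [alt, letter, e1, e2, if_true, if_false, List.map, List.prod_cons, List.prod_nil,
        mul_one, LinearEquiv.mul_apply]
      rw [st x]; simp only [ca, cb]; push_cast; module
  · refine ⟨3, fun k hk => key k ?_, [a, b], by simp, ?_⟩
    · interval_cases k <;> decide
    · ext x
      simp only [alt, letter, e1, e2, e3, if_true, if_false, List.map, List.prod_cons,
        List.prod_nil, mul_one, LinearEquiv.mul_apply]
      rw [st x]; simp only [ca, cb]; push_cast; module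
  · refine ⟨4, fun k hk => key k ?_, [b, a, b], by simp, ?_⟩
    · interval_cases k <;> decide
    · ext x
      simp only [alt, letter, e1, e2, e3, e4, if_true, if_false, List.map, List.prod_cons,
        List.prod_nil, mul_one, LinearEquiv.mul_apply]
      rw [st x]; simp only [ca, cb]; push_cast; module
  · refine ⟨4, fun k hk => key k ?_, [b, a, b], by simp, ?_⟩
    · interval_cases k <;> decide
    · ext x
      simp only [alt, letter, e1, e2, e3, e4, if_true, if_false, List.map, List.prod_cons,
        List.prod_nil, mul_one, LinearEquiv.mul_apply]
      rw [st x]; simp only [ca, cb]; push_cast; module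
  · refine ⟨6, fun k hk => key k ?_, [b, a, b, a, b], by simp, ?_⟩
    · interval_cases k <;> decide
    · ext x
      simp only [alt, letter, e1, e2, e3, e4, e5, e6, if_true, if_false, List.map, List.prod_cons,
        List.prod_nil, mul_one, LinearEquiv.mul_apply]
      rw [st x]; simp only [ca, cb]; push_cast; module
  · refine ⟨6, fun k hk => key k ?_, [b, a, b, a, b], by simp, ?_⟩
    · interval_cases k <;> decide
    · ext x
      simp only [alt, letter, e1, e2, e3, e4, e5, e6, if_true, if_false, List.map, List.prod_cons,
        List.prod_nil, mul_one, LinearEquiv.mul_apply]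
      rw [st x]; simp only [ca, cb]; push_cast; module

theorem alt_mem (a b : Fin m) (k : ℕ) : S.alt a b k ∈ S.W := by
  induction k with
  | zero => exact S.W.one_mem
  | succ k ih => exact S.W.mul_mem (S.s_mem _) ih

/-- Positivity of roots. -/
theorem root_pos (n : ℕ) : ∀ w ∈ S.W, S.len w = n → ∀ a, S.len w ≤ S.len (w * S.s a) →
    w (S.root a) ∈ AddSubmonoid.closure (Set.range S.root) := by
  induction n using Nat.strong_induction_on with
  | _ n ih =>
  intro w hw hn a ha
  by_cases h0 : S.len w = 0
  · rw [S.len_zero hw h0]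
    exact AddSubmonoid.subset_closure ⟨a, rfl⟩
  obtain ⟨b, hb⟩ := S.exists_descent hw h0
  have hab : a ≠ b := by rintro rfl; omega
  let v : ℕ → (V ≃ₗ[ℝ] V) := fun k => w * (S.alt a b k)⁻¹
  have hvW : ∀ k, v k ∈ S.W := fun k => S.W.mul_mem hw (S.W.inv_mem (S.alt_mem a b k))
  have hvs : ∀ k, v (k + 1) = v k * S.s (letter a b k) := by
    intro k
    simp only [v, alt, mul_inv_rev, s_inv, mul_assoc]
  have hvs' : ∀ k, v k = v (k + 1) * S.s (letter a b k) := by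
    intro k
    rw [hvs, mul_assoc, s_mul_self, mul_one]
  have hvw : ∀ k, w = v k * S.alt a b k := by intro k; simp [v]
  have hv0 : v 0 = w := by simp [v, alt]
  have hlow : ∀ k, S.len w ≤ S.len (v k) + k := by
    intro k
    induction k with
    | zero => simp [hv0]
    | succ k ihk =>
      have := S.len_mul_s (hvW (k + 1)) (letter a b k)
      rw [← hvs'] at this
      omega
  have hex : ∃ k, ¬ (S.len (v k) + k ≤ S.len w) := ⟨S.len w + 1, by omega⟩
  classical
  obtain ⟨K, hK⟩ : ∃ K, K = Nat.find hex := ⟨_, rfl⟩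
  have hKs : ¬ (S.len (v K) + K ≤ S.len w) := hK ▸ Nat.find_spec hex
  have hKm : ∀ j < K, S.len (v j) + j ≤ S.len w := by
    intro j hj
    by_contra h
    exact Nat.find_min hex (hK ▸ hj) h
  have h1 : S.len (v 1) + 1 ≤ S.len w := by
    have : v 1 = w * S.s b := by rw [hvs, hv0]; simp [letter]
    rw [this]; omega
  have hK2 : 2 ≤ K := by
    by_contra h
    have : K = 0 ∨ K = 1 := by omega
    rcases this with h | h
    · rw [h, hv0] at hKs; omega
    · rw [h] at hKs; omega
  obtain ⟨k, rfl⟩ : ∃ k, K = k + 2 := ⟨K - 2, by omega⟩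
  have hk1 := hKm (k + 1) (by omega)
  have hKs' : ¬ (S.len (v (k + 1 + 1)) + (k + 2) ≤ S.len w) := hKs
  have A1 : v (k + 1) (S.root (letter a b (k + 1))) ∈
      AddSubmonoid.closure (Set.range S.root) := by
    refine ih (S.len (v (k + 1))) (by omega) _ (hvW _) rfl _ ?_
    rw [← hvs]; omega
  have A2 : v (k + 1) (S.root (letter a b k)) ∈ AddSubmonoid.closure (Set.range S.root) := by
    refine ih (S.len (v (k + 1))) (by omega) _ (hvW _) rfl _ ?_
    rw [← hvs']
    have := hlow k
    omega
  have A : v (k + 1) (S.root a) ∈ AddSubmonoid.closure (Set.range S.root) ∧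
      v (k + 1) (S.root b) ∈ AddSubmonoid.closure (Set.range S.root) := by
    by_cases hk : Even k
    · simp only [letter, Nat.even_add_one, hk, not_true, if_false, if_true] at A1 A2
      exact ⟨A1, A2⟩
    · simp only [letter, Nat.even_add_one, hk, not_false_iff, if_false, if_true] at A1 A2
      exact ⟨A2, A1⟩
  have hgood : S.Good a b (k + 1) := by
    rcases S.rank_two a b hab with h | ⟨M, hM, l, hl, hlM⟩
    · exact h _
    · apply hM
      by_contra hlt
      have h2 := hKm M (by omega)
      have h3 := S.len_mul_prod (hvW M) l
      rw [← hlM, ← mul_assoc, ← hvw] at h3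
      omega
  obtain ⟨x, y, hxy⟩ := hgood
  have : w (S.root a) = x • v (k + 1) (S.root a) + y • v (k + 1) (S.root b) := by
    conv_lhs => rw [hvw (k + 1)]
    rw [LinearEquiv.mul_apply, hxy, map_add, map_nsmul, map_nsmul]
  rw [this]
  exact add_mem (nsmul_mem A.1 x) (nsmul_mem A.2 y)

/-- the discrete cone attached to μ -/
noncomputable def disc (μ : V) : AddSubmonoid V :=
  AddSubmonoid.closure {v | ∃ i j, v = S.coroot i μ • S.root j}

theorem smul_root_disc (μ : V) (i : Fin m) {v : V}
    (hv : v ∈ AddSubmonoid.closure (Set.range S.root)) : S.coroot i μ • v ∈ S.disc μ := by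
  induction hv using AddSubmonoid.closure_induction with
  | mem x hx => obtain ⟨j, rfl⟩ := hx; exact AddSubmonoid.subset_closure ⟨i, j, rfl⟩
  | zero => simp
  | add x y _ _ hx hy => rw [smul_add]; exact add_mem hx hy

theorem sub_mem_disc (μ : V) (n : ℕ) : ∀ w ∈ S.W, S.len w = n → μ - w μ ∈ S.disc μ := by
  induction n using Nat.strong_induction_on with
  | _ n ih =>
  intro w hw hn
  by_cases h0 : S.len w = 0
  · rw [S.len_zero hw h0]; simp
  obtain ⟨b, hb⟩ := S.exists_descent hw h0
  have hw' := S.W.mul_mem hw (S.s_mem b)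
  have e : w * S.s b * S.s b = w := by rw [mul_assoc, s_mul_self, mul_one]
  have h1 := ih _ (by omega) _ hw' rfl
  have h2 := S.root_pos _ _ hw' rfl b (by rw [e]; omega)
  have h3 : μ - w μ = (μ - (w * S.s b) μ) + S.coroot b μ • (w * S.s b) (S.root b) := by
    conv_lhs => rw [← e]
    rw [LinearEquiv.mul_apply, S.s_apply b μ, map_sub, map_smul]
    module
  rw [h3]
  exact add_mem h1 (S.smul_root_disc μ b h2)

theorem disc_cone (μ : V) (hμ : μ ∈ S.chamber) {v : V} (hv : v ∈ S.disc μ) :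
    v ∈ S.coneNonneg univ := by
  induction hv using AddSubmonoid.closure_induction with
  | mem x hx =>
    obtain ⟨i, j, rfl⟩ := hx
    refine ⟨Pi.single j (S.coroot i μ), ?_, by simp, ?_⟩
    · intro k
      by_cases h : k = j
      · subst h; simpa using hμ i
      · simp [h]
    · simp [Pi.single_apply, ite_smul]
  | zero => exact ⟨0, by simp⟩
  | add x y _ _ hx hy =>
    obtain ⟨c, h1, -, rfl⟩ := hx
    obtain ⟨d, h2, -, rfl⟩ := hy
    refine ⟨c + d, fun i => add_nonneg (h1 i) (h2 i), by simp, ?_⟩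
    simp [add_smul, Finset.sum_add_distrib]

theorem exists_coord : ∃ φ : V →ₗ[ℝ] (Fin m → ℝ), ∀ c : Fin m → ℝ,
    φ (∑ i, c i • S.root i) = c := by
  have h := S.root_indep
  rw [linearIndependent_iff_injective_fintypeLinearCombination] at h
  obtain ⟨φ, hφ⟩ := LinearMap.exists_leftInverse_of_injective _ (LinearMap.ker_eq_bot.2 h)
  refine ⟨φ, fun c => ?_⟩
  simpa [Fintype.linearCombination_apply] using LinearMap.congr_fun hφ c

/-- coordinates with respect to the simple roots -/
noncomputable def crd : V →ₗ[ℝ] (Fin m → ℝ) := S.exists_coord.choose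

theorem crd_sum (c : Fin m → ℝ) : S.crd (∑ i, c i • S.root i) = c := S.exists_coord.choose_spec c

theorem crd_root (j : Fin m) : S.crd (S.root j) = Pi.single j 1 := by
  have := S.crd_sum (Pi.single j 1)
  simpa [Pi.single_apply, ite_smul] using this

theorem cone_iff (I : Set (Fin m)) (v : V) :
    v ∈ S.coneNonneg I ↔ v ∈ S.coneNonneg univ ∧ ∀ i, i ∉ I → S.crd v i = 0 := by
  constructor
  · rintro ⟨c, h1, h2, rfl⟩
    refine ⟨⟨c, h1, by simp, rfl⟩, ?_⟩
    rw [crd_sum]; exact h2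
  · rintro ⟨⟨c, h1, -, rfl⟩, h2⟩
    rw [crd_sum] at h2
    exact ⟨c, h1, h2, rfl⟩

theorem cone_crd_nonneg {v : V} (h : v ∈ S.coneNonneg univ) (i : Fin m) : 0 ≤ S.crd v i := by
  obtain ⟨c, h1, -, rfl⟩ := h
  rw [crd_sum]; exact h1 i

theorem cone_eq {v : V} (h : v ∈ S.coneNonneg univ) : v = ∑ i, S.crd v i • S.root i := by
  obtain ⟨c, h1, -, rfl⟩ := h
  rw [crd_sum]

theorem cone_convex (I : Set (Fin m)) : Convex ℝ (S.coneNonneg I) := by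
  rintro _ ⟨c, h1, h2, rfl⟩ _ ⟨d, h3, h4, rfl⟩ s t hs ht -
  refine ⟨s • c + t • d, ?_, ?_, ?_⟩
  · intro i
    exact add_nonneg (mul_nonneg hs (h1 i)) (mul_nonneg ht (h3 i))
  · intro i hi; simp [h2 i hi, h4 i hi]
  · simp [add_smul, Finset.sum_add_distrib, Finset.smul_sum, mul_smul]

theorem WI_le (I : Set (Fin m)) : S.WI I ≤ S.W :=
  Subgroup.closure_mono (Set.image_subset_range _ _)

theorem WI_crd (I : Set (Fin m)) {u : V ≃ₗ[ℝ] V} (hu : u ∈ S.WI I) :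
    ∀ x i, i ∉ I → S.crd (u x) i = S.crd x i := by
  induction hu using Subgroup.closure_induction with
  | mem w hw =>
    obtain ⟨j, hj, rfl⟩ := hw
    intro x i hi
    have : i ≠ j := by rintro rfl; exact hi hj
    simp [s_apply, crd_root, this]
  | one => simp
  | mul x y _ _ hx hy =>
    intro z i hi
    rw [LinearEquiv.mul_apply, hx _ i hi, hy _ i hi]
  | inv x _ hx =>
    intro z i hi
    rw [← hx _ i hi, ← LinearEquiv.mul_apply]
    simp

theorem orbit_cone (μ : V) (hμ : μ ∈ S.chamber) {w : V ≃ₗ[ℝ] V} (hw : w ∈ S.W) :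
    μ - w μ ∈ S.coneNonneg univ :=
  S.disc_cone μ hμ (S.sub_mem_disc μ _ w hw rfl)

theorem hull_cone (μ : V) (hμ : μ ∈ S.chamber) {x : V} (hx : x ∈ S.orbitHull μ) :
    μ - x ∈ S.coneNonneg univ := by
  have hc : Convex ℝ {x : V | μ - x ∈ S.coneNonneg univ} := by
    intro x hx y hy s t hs ht hst
    have := S.cone_convex univ hx hy hs ht hst
    have e : μ - (s • x + t • y) = s • (μ - x) + t • (μ - y) := by
      obtain rfl : t = 1 - s := by linarith
      module
    simpa only [mem_setOf_eq, e] using this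
  refine convexHull_min ?_ hc hx
  rintro _ ⟨w, hw, rfl⟩
  exact S.orbit_cone μ hμ hw

theorem hull_invariant (μ : V) (G : Subgroup (V ≃ₗ[ℝ] V)) {u : V ≃ₗ[ℝ] V} (hu : u ∈ G)
    {x : V} (hx : x ∈ convexHull ℝ (orbitOf G μ)) : u x ∈ convexHull ℝ (orbitOf G μ) := by
  have h := mem_image_of_mem (u : V →ₗ[ℝ] V) hx
  rw [LinearMap.image_convexHull] at h
  refine convexHull_mono ?_ h
  rintro _ ⟨_, ⟨w, hw, rfl⟩, rfl⟩
  exact ⟨u * w, G.mul_mem hu hw, rfl⟩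

/-- height -/
noncomputable def ht : V →ₗ[ℝ] ℝ := (∑ i, LinearMap.proj i) ∘ₗ S.crd

theorem ht_root (j : Fin m) : S.ht (S.root j) = 1 := by
  simp [ht, crd_root]

theorem ht_disc (μ : V) {v : V} (hv : v ∈ S.disc μ) :
    S.ht v ∈ AddSubmonoid.closure (Set.range fun i => S.coroot i μ) := by
  induction hv using AddSubmonoid.closure_induction with
  | mem x hx =>
    obtain ⟨i, j, rfl⟩ := hx
    rw [map_smul, ht_root, smul_eq_mul, mul_one]
    exact AddSubmonoid.subset_closure ⟨i, rfl⟩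
  | zero => simp
  | add x y _ _ hx hy => rw [map_add]; exact add_mem hx hy

theorem exists_min (μ : V) (hμ : μ ∈ S.chamber) (I : Set (Fin m)) {x : V}
    (hx : x ∈ S.orbitHull μ) :
    ∃ u ∈ S.WI I, ∀ u' ∈ S.WI I, S.ht (μ - u x) ≤ S.ht (μ - u' x) := by
  rw [orbitHull, mem_convexHull_iff_exists_fintype] at hx
  obtain ⟨ι, _, t, z, ht0, ht1, hz, rfl⟩ := hx
  let M : AddSubmonoid ℝ :=
    AddSubmonoid.closure (Set.range fun p : ι × Fin m => t p.1 * S.coroot p.2 μ)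
  have hM : (M : Set ℝ).IsPWO := by
    apply Set.IsPWO.addSubmonoid_closure
    · rintro _ ⟨p, rfl⟩
      exact mul_nonneg (ht0 _) (hμ _)
    · exact (Set.finite_range _).isPWO
  have hmul : ∀ k, ∀ r ∈ AddSubmonoid.closure (Set.range fun i => S.coroot i μ),
      t k * r ∈ M := by
    intro k r hr
    induction hr using AddSubmonoid.closure_induction with
    | mem x hx =>
      obtain ⟨i, rfl⟩ := hx
      exact AddSubmonoid.subset_closure ⟨(k, i), rfl⟩
    | zero => simp
    | add x y _ _ hx hy => rw [mul_add]; exact add_mem hx hy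
  have hsub : ∀ u ∈ S.WI I, S.ht (μ - u (∑ i, t i • z i)) ∈ M := by
    intro u hu
    have e : μ - u (∑ i, t i • z i) = ∑ i, t i • (μ - u (z i)) := by
      simp only [map_sum, map_smul, smul_sub, Finset.sum_sub_distrib, ← Finset.sum_smul, ht1,
        one_smul]
    rw [e, map_sum]
    refine sum_mem fun k _ => ?_
    rw [map_smul, smul_eq_mul]
    apply hmul
    apply S.ht_disc
    obtain ⟨w, hw, hwz⟩ := hz k
    rw [← hwz]
    exact S.sub_mem_disc μ _ (u * w) (S.W.mul_mem (S.WI_le I hu) hw) rfl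
  let T : Set ℝ := (fun u : V ≃ₗ[ℝ] V => S.ht (μ - u (∑ i, t i • z i))) '' (S.WI I : Set _)
  have hT : T.IsWF := by
    refine (hM.mono ?_).isWF
    rintro _ ⟨u, hu, rfl⟩
    exact hsub u hu
  have hne : T.Nonempty := ⟨_, 1, (S.WI I).one_mem, rfl⟩
  obtain ⟨u, hu, hmin⟩ := hT.min_mem hne
  refine ⟨u, hu, fun u' hu' => ?_⟩
  have := hT.min_le hne (a := S.ht (μ - u' (∑ i, t i • z i))) ⟨u', hu', rfl⟩
  rw [← hmin] at this
  exact this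

theorem to_chamber (μ : V) (hμ : μ ∈ S.chamber) (I : Set (Fin m)) {x : V}
    (hx : x ∈ S.orbitHull μ) (hxI : μ - x ∈ S.coneNonneg I) :
    ∃ u ∈ S.WI I, u x ∈ S.chamber ∧ μ - u x ∈ S.coneNonneg I := by
  obtain ⟨u, hu, hmin⟩ := S.exists_min μ hμ I hx
  have hc : μ - u x ∈ S.coneNonneg I := by
    rw [cone_iff]
    refine ⟨S.hull_cone μ hμ (hull_invariant μ S.W (S.WI_le I hu) hx), fun i hi => ?_⟩
    have := ((S.cone_iff I _).1 hxI).2 i hi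
    rw [map_sub, Pi.sub_apply] at this ⊢
    rw [S.WI_crd I hu x i hi, this]
  refine ⟨u, hu, fun i => ?_, hc⟩
  by_cases hi : i ∈ I
  · have h := hmin (S.s i * u)
      ((S.WI I).mul_mem (Subgroup.subset_closure ⟨i, hi, rfl⟩) hu)
    rw [LinearEquiv.mul_apply, s_apply] at h
    simp only [map_sub, map_smul, ht_root, smul_eq_mul, mul_one] at h
    linarith
  · obtain ⟨c, h1, h2, h3⟩ := hc
    have e : u x = μ - ∑ j, c j • S.root j := by rw [← h3]; abel
    rw [e, map_sub, map_sum]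
    have h4 : ∑ j, S.coroot i (c j • S.root j) ≤ 0 := by
      apply Finset.sum_nonpos
      intro j _
      rw [map_smul, smul_eq_mul, S.pairing]
      by_cases hij : i = j
      · subst hij; rw [h2 i hi]; simp
      · have : (S.A i j : ℝ) ≤ 0 := by exact_mod_cast S.A_offdiag i j hij
        exact mul_nonpos_of_nonneg_of_nonpos (h1 j) this
    have := hμ i
    linarith

theorem orbit_WI (μ : V) (hμ : μ ∈ S.chamber) (I : Set (Fin m)) {x : V}
    (hx : x ∈ orbitOf S.W μ) (hxI : μ - x ∈ S.coneNonneg I) : x ∈ orbitOf (S.WI I) μ := by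
  obtain ⟨u, hu, hux, hc⟩ := S.to_chamber μ hμ I (subset_convexHull ℝ _ hx) hxI
  obtain ⟨w, hw, hwx⟩ := hx
  have hwx' : w μ = x := hwx
  have hW : u * w ∈ S.W := S.W.mul_mem (S.WI_le I hu) hw
  have h1 := S.orbit_cone (u x) hux (S.W.inv_mem hW)
  have e : (u * w)⁻¹ (u x) = μ := by
    rw [← hwx', ← LinearEquiv.mul_apply u w, ← LinearEquiv.mul_apply]; simp
  rw [e] at h1
  have h2 := ((S.cone_iff I _).1 hc).1
  have h3 : S.crd (μ - u x) = 0 := by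
    funext i
    have a1 := S.cone_crd_nonneg h1 i
    have a2 := S.cone_crd_nonneg h2 i
    simp only [map_sub, Pi.sub_apply, Pi.zero_apply] at a1 a2 ⊢
    linarith
  have h4 := S.cone_eq h2
  rw [h3] at h4
  simp only [Pi.zero_apply, zero_smul, Finset.sum_const_zero] at h4
  have h5 : μ = u x := sub_eq_zero.1 h4
  refine ⟨u⁻¹, (S.WI I).inv_mem hu, ?_⟩
  change u⁻¹ μ = x
  rw [h5, ← LinearEquiv.mul_apply]; simp

theorem orbit_sub (μ : V) (I : Set (Fin m)) : orbitOf (S.WI I) μ ⊆ orbitOf S.W μ :=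
  Set.image_mono (S.WI_le I)

theorem face_sub (μ : V) (I : Set (Fin m)) : S.face μ I ⊆ S.orbitHull μ :=
  convexHull_mono (S.orbit_sub μ I)

theorem face_cone (μ : V) (hμ : μ ∈ S.chamber) (I : Set (Fin m)) {x : V}
    (hx : x ∈ S.face μ I) : μ - x ∈ S.coneNonneg I := by
  rw [cone_iff]
  refine ⟨S.hull_cone μ hμ (S.face_sub μ I hx), ?_⟩
  have hc : Convex ℝ {x : V | ∀ i, i ∉ I → S.crd (μ - x) i = 0} := by
    intro x hx y hy s t hs ht hst i hi
    have h1 := hx i hi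
    have h2 := hy i hi
    simp only [map_sub, map_add, map_smul, Pi.sub_apply, Pi.add_apply, Pi.smul_apply,
      smul_eq_mul] at h1 h2 ⊢
    have e1 : S.crd x i = S.crd μ i := by linarith
    have e2 : S.crd y i = S.crd μ i := by linarith
    rw [e1, e2]
    linear_combination - (S.crd μ i) * hst
  refine convexHull_min ?_ hc hx
  rintro _ ⟨w, hw, rfl⟩ i hi
  simp [S.WI_crd I hw μ i hi]

/-- functional exposing the face -/
noncomputable def expo (I : Set (Fin m)) : V →ₗ[ℝ] ℝ := by
  classical
  exact (∑ i, if i ∈ I then 0 else LinearMap.proj i) ∘ₗ S.crd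

theorem expo_apply (I : Set (Fin m)) (v : V) [DecidablePred (· ∈ I)] :
    S.expo I v = ∑ i, if i ∈ I then 0 else S.crd v i := by
  simp only [expo, LinearMap.comp_apply, LinearMap.sum_apply]
  apply Finset.sum_congr rfl
  intro i _
  by_cases h : i ∈ I <;> simp [h]

theorem expo_nonneg (I : Set (Fin m)) {v : V} (hv : v ∈ S.coneNonneg univ) :
    0 ≤ S.expo I v := by
  classical
  rw [expo_apply]
  apply Finset.sum_nonneg
  intro i _
  split_ifs
  · exact le_rfl
  · exact S.cone_crd_nonneg hv i

theorem expo_zero (I : Set (Fin m)) {v : V} (hv : v ∈ S.coneNonneg univ) :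
    S.expo I v = 0 ↔ v ∈ S.coneNonneg I := by
  classical
  rw [expo_apply, cone_iff, Finset.sum_eq_zero_iff_of_nonneg]
  · constructor
    · intro h
      refine ⟨hv, fun i hi => ?_⟩
      simpa [hi] using h i (Finset.mem_univ i)
    · rintro ⟨-, h⟩ i -
      split_ifs with hi
      · rfl
      · exact h i hi
  · intro i _
    split_ifs
    · exact le_rfl
    · exact S.cone_crd_nonneg hv i

theorem mem_orbit_self (G : Subgroup (V ≃ₗ[ℝ] V)) (μ : V) : μ ∈ orbitOf G μ :=
  ⟨1, G.one_mem, rfl⟩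

theorem face_of_cone (μ : V) (hμ : μ ∈ S.chamber) (I : Set (Fin m)) {x : V}
    (hx : x ∈ S.orbitHull μ) (hxI : μ - x ∈ S.coneNonneg I) : x ∈ S.face μ I := by
  rw [orbitHull, mem_convexHull_iff_exists_fintype] at hx
  obtain ⟨ι, _, t, z, ht0, ht1, hz, rfl⟩ := hx
  have hzc : ∀ k, μ - z k ∈ S.coneNonneg univ := fun k =>
    S.hull_cone μ hμ (subset_convexHull ℝ _ (hz k))
  have e : μ - (∑ i, t i • z i) = ∑ i, t i • (μ - z i) := by
    simp only [smul_sub, Finset.sum_sub_distrib, ← Finset.sum_smul, ht1, one_smul]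
  have h0 := (S.expo_zero I ((S.cone_iff I _).1 hxI).1).2 hxI
  rw [e, map_sum, Finset.sum_eq_zero_iff_of_nonneg] at h0
  · have key : ∀ k, t k ≠ 0 → z k ∈ orbitOf (S.WI I) μ := by
      intro k hk
      have := h0 k (Finset.mem_univ k)
      rw [map_smul, smul_eq_mul] at this
      have h1 := (mul_eq_zero.1 this).resolve_left hk
      exact S.orbit_WI μ hμ I (hz k) ((S.expo_zero I (hzc k)).1 h1)
    classical
    have e2 : ∑ i, t i • z i = ∑ i, t i • (if t i = 0 then μ else z i) := by
      apply Finset.sum_congr rfl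
      intro i _
      split_ifs with h
      · simp [h]
      · rfl
    rw [e2, face]
    apply (convex_convexHull ℝ _).sum_mem (fun i _ => ht0 i) ht1
    intro i _
    apply subset_convexHull
    split_ifs with h
    · exact mem_orbit_self _ μ
    · exact key i h
  · intro k _
    rw [map_smul]
    exact mul_nonneg (ht0 k) (S.expo_nonneg I (hzc k))

theorem face_exposed (μ : V) (hμ : μ ∈ S.chamber) (I : Set (Fin m)) :
    IsExposed ℝ (S.orbitHull μ) (S.face μ I) := by
  intro _
  haveI := S.finDim
  refine ⟨LinearMap.toContinuousLinearMap (S.expo I), ?_⟩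
  have hμH : μ ∈ S.orbitHull μ := subset_convexHull ℝ _ (mem_orbit_self _ μ)
  ext x
  simp only [LinearMap.coe_toContinuousLinearMap', mem_setOf_eq]
  constructor
  · intro hx
    have hxH := S.face_sub μ I hx
    refine ⟨hxH, fun y hy => ?_⟩
    have h1 := (S.expo_zero I (S.hull_cone μ hμ hxH)).2 (S.face_cone μ hμ I hx)
    have h2 := S.expo_nonneg I (S.hull_cone μ hμ hy)
    rw [map_sub] at h1 h2
    linarith
  · rintro ⟨hxH, hx⟩
    apply S.face_of_cone μ hμ I hxH
    rw [← S.expo_zero I (S.hull_cone μ hμ hxH)]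
    have h1 := hx μ hμH
    have h2 := S.expo_nonneg I (S.hull_cone μ hμ hxH)
    rw [map_sub] at h2 ⊢
    linarith

end aux

end GCMRealization

open GCMRealization in
theorem statement_1 {m : ℕ} {V : Type*} [NormedAddCommGroup V] [NormedSpace ℝ V]
    (S : GCMRealization m V) (μ : V) (hμ : μ ∈ S.chamber)
    (I : Set (Fin m)) :
    IsFaceOf (S.orbitHull μ) (S.face μ I) ∧
    IsExposed ℝ (S.orbitHull μ) (S.face μ I) ∧
    S.face μ I = S.orbitHull μ ∩ ((fun v => μ - v) '' S.coneNonneg I) ∧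
    S.face μ I =
      Set.image2 (fun (w : V ≃ₗ[ℝ] V) (x : V) => w x) (S.WI I : Set (V ≃ₗ[ℝ] V))
        (S.face μ I ∩ S.chamber) ∧
    S.face μ I ∩ orbitOf S.W μ = orbitOf (S.WI I) μ := by
  have hexp := S.face_exposed μ hμ I
  refine ⟨⟨convex_convexHull ℝ _, hexp.isExtreme⟩, hexp, ?_, ?_, ?_⟩
  · ext x
    constructor
    · intro hx
      exact ⟨S.face_sub μ I hx, μ - x, S.face_cone μ hμ I hx, by simp⟩
    · rintro ⟨hx, v, hv, rfl⟩
      exact S.face_of_cone μ hμ I hx (by simpa using hv)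
  · ext x
    constructor
    · intro hx
      obtain ⟨u, hu, huc, -⟩ := S.to_chamber μ hμ I (S.face_sub μ I hx) (S.face_cone μ hμ I hx)
      refine ⟨u⁻¹, (S.WI I).inv_mem hu, u x, ⟨hull_invariant μ _ hu hx, huc⟩, ?_⟩
      change u⁻¹ (u x) = x
      rw [← LinearEquiv.mul_apply]; simp
    · rintro ⟨u, hu, y, ⟨hy, -⟩, rfl⟩
      exact hull_invariant μ _ hu hy
  · ext x
    constructor
    · rintro ⟨hx, hxo⟩
      exact S.orbit_WI μ hμ I hxo (S.face_cone μ hμ I hx)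
    · intro hx
      exact ⟨subset_convexHull ℝ _ hx, S.orbit_sub μ I hx⟩
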